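/- Let A be an n×n complex matrix, B an m×m complex matrix, and C = A ⊕ B the (n+m)×(n+m) block-diagonal matrix with diagonal blocks A and B. If C is logarithmic affine, then A is logarithmic affine or B is logarithmic affine; moreover, either ‖A‖_{p,p} = ‖C‖_{p,p} for all p ∈ [1,∞], or ‖B‖_{p,p} = ‖C‖_{p,p} for all p ∈ [1,∞]. -/

import Mathlib

open scoped BigOperators ENNReal
open Matrix

/-- The `ℓ^p` norm of a finitely-indexed vector (with the convention `1/∞ = 0`). -/
noncomputable def lpNorm {ι : Type*} [Fintype ι] {E : Type*} [Norm E] (p : ℝ≥0∞)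
    (x : ι → E) : ℝ :=
  if p = ∞ then ⨆ i, ‖x i‖ else (∑ i, ‖x i‖ ^ p.toReal) ^ p.toReal⁻¹

/-- The operator norm of a square complex matrix acting on `ℓ^p`. -/
noncomputable def opNorm {ι : Type*} [Fintype ι] (p : ℝ≥0∞) (A : Matrix ι ι ℂ) : ℝ :=
  sSup {r : ℝ | ∃ x : ι → ℂ, lpNorm p x = 1 ∧ r = lpNorm p (A.mulVec x)}

/-- A unitary permutation matrix: a permutation matrix whose nonzero entries are
unimodular complex numbers. -/
def IsUnitaryPermutation {n : ℕ} (S : Matrix (Fin n) (Fin n) ℂ) : Prop :=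
  ∃ (σ : Equiv.Perm (Fin n)) (α : Fin n → ℂ), (∀ i, ‖α i‖ = 1) ∧
    ∀ i j, S i j = if j = σ i then α i else 0

/-- `A` is logarithmic affine: `‖A‖_{p,p} = ‖A‖_{1,1}^{1/p} ‖A‖_{∞,∞}^{1-1/p}` for all
`p ∈ [1,∞]` (with `1/∞ = 0`). -/
def LogAffine {ι : Type*} [Fintype ι] (A : Matrix ι ι ℂ) : Prop :=
  ∀ p : ℝ≥0∞, 1 ≤ p →
    opNorm p A = opNorm 1 A ^ p.toReal⁻¹ * opNorm ⊤ A ^ (1 - p.toReal⁻¹)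

/-- The circulant matrix `C(α₀,…,α_{n-1})`, whose `(i,j)` entry is `α_{j-i mod n}`. -/
noncomputable def circulantC {n : ℕ} (α : Fin n → ℂ) : Matrix (Fin n) (Fin n) ℂ :=
  Matrix.of fun i j => α (j - i)

/-- The Hankel-type matrix `H(α₀,…,α_{n-1})`, whose `(i,j)` entry is `α_{i+j mod n}`. -/
noncomputable def hankelH {n : ℕ} (α : Fin n → ℂ) : Matrix (Fin n) (Fin n) ℂ :=
  Matrix.of fun i j => α (i + j)

section LpNorm

variable {ι κ : Type*} [Fintype ι] [Fintype κ]

theorem lpNorm_eq_norm_toLp {p : ℝ≥0∞} (hp : 1 ≤ p) (x : ι → ℂ) :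
    lpNorm p x = ‖WithLp.toLp p x‖ := by
  unfold lpNorm
  split_ifs with h
  · subst h
    rw [PiLp.norm_eq_ciSup]
  · rw [PiLp.norm_eq_sum (ENNReal.toReal_pos (zero_lt_one.trans_le hp).ne' h), one_div]

theorem lpNorm_top (x : ι → ℂ) : lpNorm ∞ x = ‖x‖ := by
  rw [lpNorm_eq_norm_toLp le_top, PiLp.norm_toLp]

theorem lpNorm_nonneg {p : ℝ≥0∞} (hp : 1 ≤ p) (x : ι → ℂ) : 0 ≤ lpNorm p x := by
  have : Fact (1 ≤ p) := ⟨hp⟩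
  rw [lpNorm_eq_norm_toLp hp]
  exact norm_nonneg _

theorem lpNorm_eq_zero_iff {p : ℝ≥0∞} (hp : 1 ≤ p) {x : ι → ℂ} : lpNorm p x = 0 ↔ x = 0 := by
  have : Fact (1 ≤ p) := ⟨hp⟩
  rw [lpNorm_eq_norm_toLp hp, norm_eq_zero, WithLp.toLp_eq_zero]

theorem lpNorm_smul {p : ℝ≥0∞} (hp : 1 ≤ p) (c : ℂ) (x : ι → ℂ) :
    lpNorm p (c • x) = ‖c‖ * lpNorm p x := by
  have : Fact (1 ≤ p) := ⟨hp⟩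
  rw [lpNorm_eq_norm_toLp hp, lpNorm_eq_norm_toLp hp, WithLp.toLp_smul, norm_smul]

theorem lpNorm_of_ne_top {p : ℝ≥0∞} (hp : p ≠ ∞) (x : ι → ℂ) :
    lpNorm p x = (∑ i, ‖x i‖ ^ p.toReal) ^ p.toReal⁻¹ :=
  if_neg hp

theorem lpNorm_one (x : ι → ℂ) : lpNorm 1 x = ∑ i, ‖x i‖ := by
  simp [lpNorm_of_ne_top]

theorem lpNorm_two_sq (x : ι → ℂ) : lpNorm 2 x ^ 2 = ∑ i, ‖x i‖ ^ 2 := by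
  rw [lpNorm_eq_norm_toLp one_le_two, EuclideanSpace.norm_sq_eq]

theorem lpNorm_sumElim_zero {p : ℝ≥0∞} (hp : 1 ≤ p) (x : ι → ℂ) :
    lpNorm p (Sum.elim x (0 : κ → ℂ)) = lpNorm p x := by
  by_cases h : p = ∞
  · subst h
    rw [lpNorm_top, lpNorm_top]
    refine le_antisymm ((pi_norm_le_iff_of_nonneg (norm_nonneg _)).2 ?_)
      ((pi_norm_le_iff_of_nonneg (norm_nonneg _)).2 fun i => ?_)
    · rintro (i | i)
      · exact norm_le_pi_norm x i
      · simp
    · exact norm_le_pi_norm (Sum.elim x (0 : κ → ℂ)) (Sum.inl i)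
  · have := (ENNReal.toReal_pos (zero_lt_one.trans_le hp).ne' h).ne'
    simp [lpNorm_of_ne_top h, Real.zero_rpow this]

theorem lpNorm_zero_sumElim {p : ℝ≥0∞} (hp : 1 ≤ p) (x : κ → ℂ) :
    lpNorm p (Sum.elim (0 : ι → ℂ) x) = lpNorm p x := by
  by_cases h : p = ∞
  · subst h
    rw [lpNorm_top, lpNorm_top]
    refine le_antisymm ((pi_norm_le_iff_of_nonneg (norm_nonneg _)).2 ?_)
      ((pi_norm_le_iff_of_nonneg (norm_nonneg _)).2 fun i => ?_)
    · rintro (i | i)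
      · simp
      · exact norm_le_pi_norm x i
    · exact norm_le_pi_norm (Sum.elim (0 : ι → ℂ) x) (Sum.inr i)
  · have := (ENNReal.toReal_pos (zero_lt_one.trans_le hp).ne' h).ne'
    simp [lpNorm_of_ne_top h, Real.zero_rpow this]

/-- Hölder's inequality for the bilinear pairing. -/
theorem norm_dotProduct_le {p q : ℝ≥0∞} (hp : p ≠ ∞) (hq : q ≠ ∞)
    (hpq : p.toReal.HolderConjugate q.toReal) (x y : ι → ℂ) :
    ‖x ⬝ᵥ y‖ ≤ lpNorm p x * lpNorm q y := by
  rw [lpNorm_of_ne_top hp, lpNorm_of_ne_top hq, ← one_div, ← one_div]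
  refine (norm_sum_le _ _).trans ?_
  simp only [norm_mul]
  exact Real.inner_le_Lp_mul_Lq_of_nonneg _ hpq (fun i _ => norm_nonneg _) fun i _ => norm_nonneg _

/-- The `ℓ^q` norm is attained on the unit ball of the conjugate space. -/
theorem exists_dotProduct_eq_lpNorm {p q : ℝ≥0∞} (hp : p ≠ ∞) (hq : q ≠ ∞)
    (hpq : p.toReal.HolderConjugate q.toReal) (z : ι → ℂ) :
    ∃ y : ι → ℂ, lpNorm p y ≤ 1 ∧ star z ⬝ᵥ y = lpNorm q z := by
  obtain ⟨⟨g, hg, hgz⟩, -⟩ := NNReal.isGreatest_Lp Finset.univ (fun i => ‖z i‖₊) hpq.symm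
  refine ⟨fun i => g i * (z i / ‖z i‖), ?_, ?_⟩
  · rw [lpNorm_of_ne_top hp]
    refine Real.rpow_le_one (Finset.sum_nonneg fun i _ => by positivity) ?_
      (inv_nonneg.2 ENNReal.toReal_nonneg)
    refine le_trans (Finset.sum_le_sum fun i _ => ?_)
      (show (∑ i, (g i : ℝ) ^ p.toReal) ≤ 1 by exact_mod_cast hg)
    refine Real.rpow_le_rpow (norm_nonneg _) ?_ ENNReal.toReal_nonneg
    rw [norm_mul, norm_div, Complex.norm_real, Complex.norm_real, norm_norm, NNReal.norm_eq]
    exact mul_le_of_le_one_right (g i).2 (div_self_le_one _)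
  · have hz : lpNorm q z = ∑ i, ‖z i‖ * (g i : ℝ) := by
      rw [lpNorm_of_ne_top hq, ← one_div]
      have := congrArg NNReal.toReal hgz
      push_cast at this
      exact this.symm
    rw [hz, Complex.ofReal_sum]
    refine Finset.sum_congr rfl fun i _ => ?_
    rw [Pi.star_apply, Complex.star_def]
    by_cases h : z i = 0
    · simp [h]
    · have h' : (‖z i‖ : ℂ) ≠ 0 := by simpa using h
      have hc := Complex.conj_mul' (z i)
      push_cast
      field_simp
      linear_combination (g i : ℂ) * hc

end LpNorm

section OpNorm

variable {ι κ : Type*} [Fintype ι] [Fintype κ]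

theorem opNorm_nonneg {p : ℝ≥0∞} (hp : 1 ≤ p) (A : Matrix ι ι ℂ) : 0 ≤ opNorm p A := by
  refine Real.sSup_nonneg ?_
  rintro _ ⟨x, -, rfl⟩
  exact lpNorm_nonneg hp _

theorem exists_lpNorm_mulVec_le {p : ℝ≥0∞} (hp : 1 ≤ p) (A : Matrix ι ι ℂ) :
    ∃ c, ∀ x, lpNorm p (A *ᵥ x) ≤ c * lpNorm p x := by
  classical
  have : Fact (1 ≤ p) := ⟨hp⟩
  let T := LinearMap.toContinuousLinearMap (Matrix.toLpLin p p A)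
  refine ⟨‖T‖, fun x => ?_⟩
  rw [lpNorm_eq_norm_toLp hp, lpNorm_eq_norm_toLp hp]
  exact T.le_opNorm (WithLp.toLp p x)

theorem lpNorm_mulVec_le {p : ℝ≥0∞} (hp : 1 ≤ p) (A : Matrix ι ι ℂ) (x : ι → ℂ) :
    lpNorm p (A *ᵥ x) ≤ opNorm p A * lpNorm p x := by
  by_cases hx : x = 0
  · subst hx
    rw [Matrix.mulVec_zero, (lpNorm_eq_zero_iff hp).2 rfl, mul_zero]
  have hx0 : lpNorm p x ≠ 0 := (lpNorm_eq_zero_iff hp).not.2 hx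
  have hpos : 0 < lpNorm p x := lt_of_le_of_ne (lpNorm_nonneg hp x) hx0.symm
  have hnorm : ‖((lpNorm p x)⁻¹ : ℂ)‖ = (lpNorm p x)⁻¹ := by
    rw [norm_inv, Complex.norm_real, Real.norm_of_nonneg hpos.le]
  have hle : lpNorm p (A *ᵥ (((lpNorm p x)⁻¹ : ℂ) • x)) ≤ opNorm p A := by
    refine le_csSup ?_ ⟨_, ?_, rfl⟩
    · obtain ⟨c, hc⟩ := exists_lpNorm_mulVec_le hp A
      refine ⟨c, ?_⟩
      rintro _ ⟨y, hy, rfl⟩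
      simpa [hy] using hc y
    · rw [lpNorm_smul hp, hnorm, inv_mul_cancel₀ hx0]
  rwa [Matrix.mulVec_smul, lpNorm_smul hp, hnorm, inv_mul_le_iff₀ hpos, mul_comm] at hle

theorem opNorm_le_of_forall {p : ℝ≥0∞} {A : Matrix ι ι ℂ} {c : ℝ} (hc : 0 ≤ c)
    (h : ∀ x, lpNorm p (A *ᵥ x) ≤ c * lpNorm p x) : opNorm p A ≤ c := by
  refine Real.sSup_le ?_ hc
  rintro _ ⟨x, hx, rfl⟩
  simpa [hx] using h x

theorem opNorm_eq_zero_iff {p : ℝ≥0∞} (hp : 1 ≤ p) {A : Matrix ι ι ℂ} :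
    opNorm p A = 0 ↔ A = 0 := by
  classical
  constructor
  · intro h
    ext i j
    have hle := lpNorm_mulVec_le hp A (Pi.single j 1)
    rw [h, zero_mul] at hle
    have := (lpNorm_eq_zero_iff hp).1 (hle.antisymm (lpNorm_nonneg hp _))
    simpa using congrFun this i
  · rintro rfl
    refine (opNorm_le_of_forall le_rfl fun x => ?_).antisymm (opNorm_nonneg hp _)
    rw [Matrix.zero_mulVec, zero_mul, (lpNorm_eq_zero_iff hp).2 rfl]

theorem lpNorm_conjTranspose_mulVec_le {p q : ℝ≥0∞} (hp : p ≠ ∞) (hq : q ≠ ∞)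
    (hp1 : 1 ≤ p) (hq1 : 1 ≤ q) (hpq : p.toReal.HolderConjugate q.toReal)
    (A : Matrix ι ι ℂ) (w : ι → ℂ) :
    lpNorm q (Aᴴ *ᵥ w) ≤ opNorm p A * lpNorm q w := by
  obtain ⟨y, hy, hyz⟩ := exists_dotProduct_eq_lpNorm hp hq hpq (Aᴴ *ᵥ w)
  have hstar : lpNorm q (star w) = lpNorm q w := by
    simp [lpNorm_of_ne_top hq]
  rw [Matrix.star_mulVec, Matrix.conjTranspose_conjTranspose, ← Matrix.dotProduct_mulVec] at hyz
  have hn : lpNorm q (Aᴴ *ᵥ w) = ‖star w ⬝ᵥ A *ᵥ y‖ := by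
    rw [hyz, Complex.norm_real, Real.norm_of_nonneg (lpNorm_nonneg hq1 _)]
  calc lpNorm q (Aᴴ *ᵥ w) ≤ lpNorm q w * lpNorm p (A *ᵥ y) := by
        rw [hn, ← hstar]
        exact norm_dotProduct_le hq hp hpq.symm _ _
    _ ≤ lpNorm q w * (opNorm p A * 1) := by
        have h1 := lpNorm_nonneg hq1 w
        have h2 := opNorm_nonneg hp1 A
        grw [lpNorm_mulVec_le hp1 A y, hy]
    _ = opNorm p A * lpNorm q w := by ring

theorem norm_conjTranspose_mulVec_le (A : Matrix ι ι ℂ) (w : ι → ℂ) :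
    ‖Aᴴ *ᵥ w‖ ≤ opNorm 1 A * ‖w‖ := by
  classical
  have h0 := opNorm_nonneg le_rfl A
  refine (pi_norm_le_iff_of_nonneg (by positivity)).2 fun i => ?_
  have hcol := lpNorm_mulVec_le le_rfl A (Pi.single i 1)
  have hsingle : lpNorm 1 (Pi.single i 1 : ι → ℂ) = 1 := by
    simp [lpNorm_eq_norm_toLp le_rfl]
  rw [hsingle, mul_one, lpNorm_one] at hcol
  calc ‖(Aᴴ *ᵥ w) i‖ ≤ ∑ j, ‖A j i‖ * ‖w‖ := by
        refine (norm_sum_le _ _).trans (Finset.sum_le_sum fun j _ => ?_)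
        rw [norm_mul, ← norm_star (A j i)]
        exact mul_le_mul_of_nonneg_left (norm_le_pi_norm w j) (norm_nonneg _)
    _ ≤ opNorm 1 A * ‖w‖ := by
        rw [← Finset.sum_mul]
        gcongr
        simpa using hcol

open scoped Matrix.Norms.L2Operator in
/-- `‖A‖_{2,2}²` is at most the modulus of some eigenvalue of `Aᴴ * A`. -/
theorem exists_eigenvector_conjTranspose_mul_self [Nonempty ι] (A : Matrix ι ι ℂ) :
    ∃ (k : ℂ) (v : ι → ℂ), v ≠ 0 ∧ Aᴴ *ᵥ (A *ᵥ v) = k • v ∧ opNorm 2 A ^ 2 ≤ ‖k‖ := by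
  classical
  obtain ⟨k, hk, hkr⟩ := spectrum.exists_nnnorm_eq_spectralRadius (star A * A)
  rw [(IsSelfAdjoint.star_mul_self A).spectralRadius_eq_nnnorm, ENNReal.coe_inj] at hkr
  have hk' : ‖k‖ = ‖A‖ * ‖A‖ := by
    rw [← Matrix.l2_opNorm_conjTranspose_mul_self]
    exact congrArg NNReal.toReal hkr
  have hle : opNorm 2 A ≤ ‖A‖ := by
    refine opNorm_le_of_forall (norm_nonneg _) fun x => ?_
    rw [lpNorm_eq_norm_toLp one_le_two, lpNorm_eq_norm_toLp one_le_two]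
    exact A.l2_opNorm_mulVec (WithLp.toLp 2 x)
  rw [spectrum.mem_iff, Matrix.isUnit_iff_isUnit_det, isUnit_iff_ne_zero, not_not] at hk
  obtain ⟨v, hv, hkv⟩ := Matrix.exists_mulVec_eq_zero_iff.2 hk
  refine ⟨k, v, hv, ?_, ?_⟩
  · rw [Matrix.sub_mulVec, sub_eq_zero, Algebra.algebraMap_eq_smul_one, Matrix.smul_mulVec,
      Matrix.one_mulVec] at hkv
    rw [Matrix.mulVec_mulVec, hkv, Matrix.star_eq_conjTranspose]
  · rw [hk', ← sq]
    exact pow_le_pow_left₀ (opNorm_nonneg one_le_two A) hle 2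

theorem opNorm_two_sq_le_of_conjTranspose {p q : ℝ≥0∞} (hp : 1 ≤ p) (hq : 1 ≤ q)
    {A : Matrix ι ι ℂ} (h : ∀ w, lpNorm q (Aᴴ *ᵥ w) ≤ opNorm p A * lpNorm q w) :
    opNorm 2 A ^ 2 ≤ opNorm p A * opNorm q A := by
  have hp0 := opNorm_nonneg hp A
  have hq0 := opNorm_nonneg hq A
  cases isEmpty_or_nonempty ι
  · rw [(opNorm_eq_zero_iff one_le_two).2 (Subsingleton.elim A 0), zero_pow two_ne_zero]
    exact mul_nonneg hp0 hq0
  obtain ⟨k, v, hv, hkv, hle⟩ := exists_eigenvector_conjTranspose_mul_self A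
  have hpos : 0 < lpNorm q v :=
    lt_of_le_of_ne (lpNorm_nonneg hq v) (Ne.symm ((lpNorm_eq_zero_iff hq).not.2 hv))
  refine hle.trans (le_of_mul_le_mul_right ?_ hpos)
  rw [← lpNorm_smul hq, ← hkv, mul_assoc]
  exact (h _).trans (mul_le_mul_of_nonneg_left (lpNorm_mulVec_le hq A v) hp0)

theorem opNorm_two_sq_le {p q : ℝ≥0∞} (hp : 1 ≤ p) (hq : 1 ≤ q)
    (hpq : p.toReal⁻¹ + q.toReal⁻¹ = 1) (A : Matrix ι ι ℂ) :
    opNorm 2 A ^ 2 ≤ opNorm p A * opNorm q A := by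
  have htop : opNorm 2 A ^ 2 ≤ opNorm 1 A * opNorm ∞ A :=
    opNorm_two_sq_le_of_conjTranspose le_rfl le_top fun w => by
      rw [lpNorm_top, lpNorm_top]
      exact norm_conjTranspose_mulVec_le A w
  have eq_one {r : ℝ≥0∞} (h : r.toReal⁻¹ = 1) : r = 1 := by
    rwa [inv_eq_one, ENNReal.toReal_eq_one_iff] at h
  by_cases hpt : p = ∞
  · subst hpt
    rw [eq_one (r := q) (by simpa using hpq), mul_comm]
    exact htop
  by_cases hqt : q = ∞
  · subst hqt
    rw [eq_one (r := p) (by simpa using hpq)]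
    exact htop
  refine opNorm_two_sq_le_of_conjTranspose hp hq
    (lpNorm_conjTranspose_mulVec_le hpt hqt hp hq ⟨by simpa using hpq, ?_, ?_⟩ A)
  · exact ENNReal.toReal_pos (zero_lt_one.trans_le hp).ne' hpt
  · exact ENNReal.toReal_pos (zero_lt_one.trans_le hq).ne' hqt

theorem exists_conjugate_exponent {p : ℝ≥0∞} (hp : 1 ≤ p) :
    ∃ q : ℝ≥0∞, 1 ≤ q ∧ p.toReal⁻¹ + q.toReal⁻¹ = 1 := by
  refine ⟨(1 - p⁻¹)⁻¹, ENNReal.one_le_inv.2 tsub_le_self, ?_⟩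
  rw [ENNReal.toReal_inv, inv_inv, ENNReal.toReal_sub_of_le (ENNReal.inv_le_one.2 hp) (by simp),
    ENNReal.toReal_inv]
  simp

theorem opNorm_le_opNorm_fromBlocks_left {p : ℝ≥0∞} (hp : 1 ≤ p) (A : Matrix ι ι ℂ)
    (B : Matrix κ κ ℂ) : opNorm p A ≤ opNorm p (Matrix.fromBlocks A 0 0 B) := by
  refine opNorm_le_of_forall (opNorm_nonneg hp _) fun x => ?_
  have := lpNorm_mulVec_le hp (Matrix.fromBlocks A 0 0 B) (Sum.elim x 0)
  rw [Matrix.fromBlocks_mulVec] at this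
  simpa [lpNorm_sumElim_zero hp] using this

theorem opNorm_le_opNorm_fromBlocks_right {p : ℝ≥0∞} (hp : 1 ≤ p) (A : Matrix ι ι ℂ)
    (B : Matrix κ κ ℂ) : opNorm p B ≤ opNorm p (Matrix.fromBlocks A 0 0 B) := by
  refine opNorm_le_of_forall (opNorm_nonneg hp _) fun x => ?_
  have := lpNorm_mulVec_le hp (Matrix.fromBlocks A 0 0 B) (Sum.elim 0 x)
  rw [Matrix.fromBlocks_mulVec] at this
  simpa [lpNorm_zero_sumElim hp] using this

theorem opNorm_two_fromBlocks_le (A : Matrix ι ι ℂ) (B : Matrix κ κ ℂ) :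
    opNorm 2 (Matrix.fromBlocks A 0 0 B) ≤ max (opNorm 2 A) (opNorm 2 B) := by
  set c := max (opNorm 2 A) (opNorm 2 B)
  have hc : 0 ≤ c := (opNorm_nonneg one_le_two A).trans (le_max_left _ _)
  refine opNorm_le_of_forall hc fun x => ?_
  have hx := lpNorm_nonneg one_le_two x
  refine (sq_le_sq₀ (lpNorm_nonneg one_le_two _) (by positivity)).1 ?_
  have hsum (y : ι ⊕ κ → ℂ) : lpNorm 2 y ^ 2 =
      lpNorm 2 (y ∘ Sum.inl) ^ 2 + lpNorm 2 (y ∘ Sum.inr) ^ 2 := by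
    simp [lpNorm_two_sq]
  have hA : lpNorm 2 (A *ᵥ (x ∘ Sum.inl)) ≤ c * lpNorm 2 (x ∘ Sum.inl) :=
    (lpNorm_mulVec_le one_le_two _ _).trans
      (mul_le_mul_of_nonneg_right (le_max_left _ _) (lpNorm_nonneg one_le_two _))
  have hB : lpNorm 2 (B *ᵥ (x ∘ Sum.inr)) ≤ c * lpNorm 2 (x ∘ Sum.inr) :=
    (lpNorm_mulVec_le one_le_two _ _).trans
      (mul_le_mul_of_nonneg_right (le_max_right _ _) (lpNorm_nonneg one_le_two _))
  rw [Matrix.fromBlocks_mulVec, hsum, mul_pow, hsum x, mul_add, ← mul_pow, ← mul_pow]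
  simp only [Sum.elim_comp_inl, Sum.elim_comp_inr, Matrix.zero_mulVec, add_zero, zero_add]
  exact add_le_add (pow_le_pow_left₀ (lpNorm_nonneg one_le_two _) hA 2)
    (pow_le_pow_left₀ (lpNorm_nonneg one_le_two _) hB 2)

theorem LogAffine.opNorm_mul_opNorm {C : Matrix κ κ ℂ} (hC : LogAffine C) {p q : ℝ≥0∞}
    (hp : 1 ≤ p) (hq : 1 ≤ q) (hpq : p.toReal⁻¹ + q.toReal⁻¹ = 1) :
    opNorm p C * opNorm q C = opNorm 1 C * opNorm ∞ C := by
  have h1 := opNorm_nonneg le_rfl C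
  have ht := opNorm_nonneg le_top C
  have hp' : 0 ≤ p.toReal⁻¹ := inv_nonneg.2 ENNReal.toReal_nonneg
  have hq' : 0 ≤ q.toReal⁻¹ := inv_nonneg.2 ENNReal.toReal_nonneg
  rw [hC p hp, hC q hq, mul_mul_mul_comm, ← Real.rpow_add_of_nonneg h1 hp' hq',
    ← Real.rpow_add_of_nonneg ht (by linarith) (by linarith), hpq, Real.rpow_one,
    show 1 - p.toReal⁻¹ + (1 - q.toReal⁻¹) = 1 by linarith, Real.rpow_one]

/-- If the operator norms of `A` are dominated by those of a logarithmic affine `C`, with equality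
at `p = 2`, then they agree for all `p`. -/
theorem LogAffine.opNorm_eq_of_opNorm_two_le {A : Matrix ι ι ℂ} {C : Matrix κ κ ℂ}
    (hC : LogAffine C) (hAC : ∀ p : ℝ≥0∞, 1 ≤ p → opNorm p A ≤ opNorm p C)
    (h2 : opNorm 2 C ≤ opNorm 2 A) {p : ℝ≥0∞} (hp : 1 ≤ p) : opNorm p A = opNorm p C := by
  obtain ⟨q, hq, hpq⟩ := exists_conjugate_exponent hp
  refine (hAC p hp).antisymm ?_
  rcases (opNorm_nonneg hq C).eq_or_lt with h | h
  · rw [(opNorm_eq_zero_iff hp).2 ((opNorm_eq_zero_iff hq).1 h.symm)]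
    exact opNorm_nonneg hp A
  refine le_of_mul_le_mul_right ?_ h
  calc opNorm p C * opNorm q C = opNorm 2 C ^ 2 := by
        rw [hC.opNorm_mul_opNorm hp hq hpq, sq,
          hC.opNorm_mul_opNorm one_le_two one_le_two (by norm_num)]
    _ ≤ opNorm 2 A ^ 2 := pow_le_pow_left₀ (opNorm_nonneg one_le_two C) h2 2
    _ ≤ opNorm p A * opNorm q A := opNorm_two_sq_le hp hq hpq A
    _ ≤ opNorm p A * opNorm q C :=
        mul_le_mul_of_nonneg_left (hAC q hq) (opNorm_nonneg hp A)

theorem LogAffine.of_opNorm_eq {A : Matrix ι ι ℂ} {C : Matrix κ κ ℂ} (hC : LogAffine C)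
    (h : ∀ p : ℝ≥0∞, 1 ≤ p → opNorm p A = opNorm p C) : LogAffine A := fun p hp => by
  rw [h p hp, h 1 le_rfl, h ∞ le_top, hC p hp]

end OpNorm

theorem statement18 {n m : ℕ} (A : Matrix (Fin n) (Fin n) ℂ) (B : Matrix (Fin m) (Fin m) ℂ)
    (hC : LogAffine (Matrix.fromBlocks A 0 0 B)) :
    (LogAffine A ∨ LogAffine B) ∧
    ((∀ p : ℝ≥0∞, 1 ≤ p → opNorm p A = opNorm p (Matrix.fromBlocks A 0 0 B)) ∨
     (∀ p : ℝ≥0∞, 1 ≤ p → opNorm p B = opNorm p (Matrix.fromBlocks A 0 0 B))) := by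
  rcases le_max_iff.1 (opNorm_two_fromBlocks_le A B) with h | h
  · have hA (p : ℝ≥0∞) (hp : 1 ≤ p) : opNorm p A = opNorm p (Matrix.fromBlocks A 0 0 B) :=
      hC.opNorm_eq_of_opNorm_two_le (fun _ hp => opNorm_le_opNorm_fromBlocks_left hp A B) h hp
    exact ⟨Or.inl (hC.of_opNorm_eq hA), Or.inl hA⟩
  · have hB (p : ℝ≥0∞) (hp : 1 ≤ p) : opNorm p B = opNorm p (Matrix.fromBlocks A 0 0 B) :=
      hC.opNorm_eq_of_opNorm_two_le (fun _ hp => opNorm_le_opNorm_fromBlocks_right hp A B) h hp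
    exact ⟨Or.inr (hC.of_opNorm_eq hB), Or.inr hB⟩
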